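/- arXiv:1312.4168 — 3 statements merged into one kernel-verified Lean document; each statement's English description precedes it below -/
import Mathlib

section
/- Let N > 4 and let η be a multi-index with 0 < |η| < m. Then there exist a finite index set S, functions C_s ∈ C_c^∞(ℝ) for s ∈ S, and nonnegative integers γ_s^1, …, γ_s^N, β_s, κ_s for s ∈ S with β_s + κ_s − Σ_{i=1}^N γ_s^i = |η| for every s ∈ S, all independent of R, such that for every R > 0 and every x ∈ A_R one has D^η φ(x) = Σ_{s∈S} [φ₀(|x|/R)]^{m−|η|} C_s(|x|/R) |x|^{−β_s} R^{−κ_s} Π_{i=1}^N x_i^{γ_s^i}. -/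
open MeasureTheory Filter

/-- The `i`-th partial derivative of `f` at `x`. -/
noncomputable def pd (N : ℕ) (i : Fin N) (f : EuclideanSpace ℝ (Fin N) → ℝ)
    (x : EuclideanSpace ℝ (Fin N)) : ℝ :=
  fderiv ℝ f x (EuclideanSpace.single i 1)

/-- The multi-index derivative `D^η f`, for a multi-index `η = (η₁, …, η_N)`. -/
noncomputable def mderiv (N : ℕ) (η : Fin N → ℕ)
    (f : EuclideanSpace ℝ (Fin N) → ℝ) : EuclideanSpace ℝ (Fin N) → ℝ :=
  (List.finRange N).foldr (fun i fc => (pd N i)^[η i] fc) f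

/-- The data of a term `C(|x|/R) |x|^{-β} R^{-κ} ∏ᵢ xᵢ^{γᵢ}`. -/
structure RadialTerm (N : ℕ) where
  coeff : ℝ → ℝ
  monoExp : Fin N → ℕ
  normExp : ℕ
  scaleExp : ℕ

namespace RadialTerm

variable {N : ℕ}

/-- The term `t`, multiplied by `φ₀(|x|/R)^p`, as a function of `R` and `x`. -/
noncomputable def eval (φ₀ : ℝ → ℝ) (p : ℕ) (t : RadialTerm N) (R : ℝ)
    (x : EuclideanSpace ℝ (Fin N)) : ℝ :=
  φ₀ (‖x‖ / R) ^ p * t.coeff (‖x‖ / R) *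
    (‖x‖ ^ t.normExp)⁻¹ * (R ^ t.scaleExp)⁻¹ * ∏ i, x i ^ t.monoExp i

/-- The coefficient is a test function, and the term is homogeneous of degree `-d` in `(x, R)`. -/
structure HasOrder (t : RadialTerm N) (d : ℕ) : Prop where
  contDiff : ContDiff ℝ (⊤ : ℕ∞) t.coeff
  hasCompactSupport : HasCompactSupport t.coeff
  balance : t.normExp + t.scaleExp = d + ∑ i, t.monoExp i

end RadialTerm

/-- On `x ≠ 0`, `R > 0`, the family `F` is a finite sum of terms of order `d`, each multiplied by
`φ₀(|x|/R)^p`. -/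
def IsRadialSum {N : ℕ} (φ₀ : ℝ → ℝ) (p d : ℕ)
    (F : ℝ → EuclideanSpace ℝ (Fin N) → ℝ) : Prop :=
  ∃ L : List (RadialTerm N), (∀ t ∈ L, t.HasOrder d) ∧
    ∀ R : ℝ, 0 < R → ∀ x : EuclideanSpace ℝ (Fin N), x ≠ 0 →
      F R x = (L.map fun t => t.eval φ₀ p R x).sum

section Derivatives

variable {N : ℕ}

lemma hasDerivAt_norm_line {x : EuclideanSpace ℝ (Fin N)} (hx : x ≠ 0) (i : Fin N) :
    HasDerivAt (fun t : ℝ => ‖x + t • EuclideanSpace.single i (1 : ℝ)‖) (x i / ‖x‖) 0 := by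
  have h1 : HasDerivAt (fun t : ℝ => x + t • EuclideanSpace.single i (1 : ℝ))
      (EuclideanSpace.single i (1 : ℝ)) 0 := by
    simpa using ((hasDerivAt_id (0 : ℝ)).smul_const
      (EuclideanSpace.single i (1 : ℝ))).const_add x
  have h2 := h1.norm_sq.sqrt (by simpa using hx)
  have hn : ‖x‖ ≠ 0 := norm_ne_zero_iff.mpr hx
  convert h2 using 1
  · funext t
    simp
  · simp [EuclideanSpace.inner_single_right]
    field_simp

lemma hasDerivAt_monomial_line (x : EuclideanSpace ℝ (Fin N)) (i : Fin N) (γ : Fin N → ℕ) :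
    HasDerivAt
      (fun t : ℝ => ∏ j, (x + t • EuclideanSpace.single i (1 : ℝ)) j ^ γ j)
      (γ i * ∏ j, x j ^ (γ - Pi.single i 1 : Fin N → ℕ) j) 0 := by
  have h1 : HasDerivAt (fun t : ℝ => (x i + t) ^ γ i * ∏ j ∈ Finset.univ.erase i, x j ^ γ j)
      (γ i * x i ^ (γ i - 1) * ∏ j ∈ Finset.univ.erase i, x j ^ γ j) 0 := by
    simpa using (((hasDerivAt_id (0 : ℝ)).const_add (x i)).pow (γ i)).mul_const
      (∏ j ∈ Finset.univ.erase i, x j ^ γ j)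
  convert h1 using 1
  · funext t
    rw [← Finset.mul_prod_erase _ _ (Finset.mem_univ i)]
    congr 1
    · simp
    · refine Finset.prod_congr rfl fun j hj => ?_
      simp [Finset.ne_of_mem_erase hj]
  · rw [← Finset.mul_prod_erase _ _ (Finset.mem_univ i), mul_assoc]
    congr 2
    · simp
    · refine Finset.prod_congr rfl fun j hj => ?_
      simp [Finset.ne_of_mem_erase hj]

lemma prod_pow_add_single (x : EuclideanSpace ℝ (Fin N)) (i : Fin N) (γ : Fin N → ℕ) :
    ∏ j, x j ^ (γ + Pi.single i 1 : Fin N → ℕ) j = x i * ∏ j, x j ^ γ j := by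
  simp only [Pi.add_apply, pow_add, Finset.prod_mul_distrib]
  simp [Pi.single_apply, pow_ite, mul_comm]

namespace RadialTerm

variable {φ₀ : ℝ → ℝ} (t : RadialTerm N)

/-- The part of `∂ᵢ t` in which `φ₀^{p+1} C` is differentiated. -/
noncomputable def pdCoeff (φ₀ : ℝ → ℝ) (p : ℕ) (i : Fin N) : RadialTerm N where
  coeff z := (p + 1) * deriv φ₀ z * t.coeff z + φ₀ z * deriv t.coeff z
  monoExp := t.monoExp + Pi.single i 1
  normExp := t.normExp + 1
  scaleExp := t.scaleExp + 1

/-- The part of `∂ᵢ t` in which `|x|^{-β}` is differentiated. -/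
noncomputable def pdNorm (φ₀ : ℝ → ℝ) (i : Fin N) : RadialTerm N where
  coeff z := -t.normExp * φ₀ z * t.coeff z
  monoExp := t.monoExp + Pi.single i 1
  normExp := t.normExp + 2
  scaleExp := t.scaleExp

/-- The part of `∂ᵢ t` in which the monomial is differentiated. -/
noncomputable def pdMono (φ₀ : ℝ → ℝ) (i : Fin N) : RadialTerm N where
  coeff z := t.monoExp i * φ₀ z * t.coeff z
  monoExp := t.monoExp - Pi.single i 1
  normExp := t.normExp
  scaleExp := t.scaleExp

variable {t}

lemma HasOrder.pdCoeff {d : ℕ} (ht : t.HasOrder d) (hφ : ContDiff ℝ (⊤ : ℕ∞) φ₀)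
    (p : ℕ) (i : Fin N) : (t.pdCoeff φ₀ p i).HasOrder (d + 1) where
  contDiff := by
    have h1 : ContDiff ℝ (⊤ : ℕ∞) (deriv φ₀) := (contDiff_infty_iff_deriv.mp hφ).2
    have h2 : ContDiff ℝ (⊤ : ℕ∞) (deriv t.coeff) := (contDiff_infty_iff_deriv.mp ht.contDiff).2
    have h3 := ht.contDiff
    exact ((contDiff_const.mul h1).mul h3).add (hφ.mul h2)
  hasCompactSupport :=
    HasCompactSupport.add (HasCompactSupport.mul_left ht.hasCompactSupport)
      (HasCompactSupport.mul_left ht.hasCompactSupport.deriv)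
  balance := by
    have := ht.balance
    simp only [RadialTerm.pdCoeff, Pi.add_apply, Finset.sum_add_distrib,
      Fintype.sum_pi_single']
    omega

lemma HasOrder.pdNorm {d : ℕ} (ht : t.HasOrder d) (hφ : ContDiff ℝ (⊤ : ℕ∞) φ₀)
    (i : Fin N) : (t.pdNorm φ₀ i).HasOrder (d + 1) where
  contDiff := (contDiff_const.mul hφ).mul ht.contDiff
  hasCompactSupport := HasCompactSupport.mul_left ht.hasCompactSupport
  balance := by
    have := ht.balance
    simp only [RadialTerm.pdNorm, Pi.add_apply, Finset.sum_add_distrib, Fintype.sum_pi_single']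
    omega

lemma HasOrder.pdMono {d : ℕ} (ht : t.HasOrder d) (hφ : ContDiff ℝ (⊤ : ℕ∞) φ₀)
    {i : Fin N} (hi : t.monoExp i ≠ 0) : (t.pdMono φ₀ i).HasOrder (d + 1) where
  contDiff := (contDiff_const.mul hφ).mul ht.contDiff
  hasCompactSupport := HasCompactSupport.mul_left ht.hasCompactSupport
  balance := by
    have h1 := ht.balance
    have h2 : t.monoExp = (t.monoExp - Pi.single i 1) + Pi.single i 1 := by
      funext j
      by_cases hj : j = i
      · subst hj
        simp
        omega
      · simp [hj]
    rw [h2] at h1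
    simp only [Pi.add_apply, Finset.sum_add_distrib, Fintype.sum_pi_single'] at h1
    simp only [RadialTerm.pdMono]
    omega

lemma eval_pdMono_eq_zero {i : Fin N} (hi : t.monoExp i = 0) (p : ℕ) (R : ℝ)
    (x : EuclideanSpace ℝ (Fin N)) : (t.pdMono φ₀ i).eval φ₀ p R x = 0 := by
  simp [eval, pdMono, hi]

lemma differentiableAt_eval (hφ : ContDiff ℝ (⊤ : ℕ∞) φ₀) (ht : ContDiff ℝ (⊤ : ℕ∞) t.coeff)
    (p : ℕ) (R : ℝ) {x : EuclideanSpace ℝ (Fin N)} (hx : x ≠ 0) :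
    DifferentiableAt ℝ (t.eval φ₀ p R) x := by
  have h1 : Differentiable ℝ φ₀ := hφ.differentiable (by simp)
  have h2 : Differentiable ℝ t.coeff := ht.differentiable (by simp)
  have h3 : DifferentiableAt ℝ (fun y : EuclideanSpace ℝ (Fin N) => ‖y‖) x :=
    (contDiffAt_norm ℝ hx (n := 1)).differentiableAt (by simp)
  have h4 : DifferentiableAt ℝ (fun y : EuclideanSpace ℝ (Fin N) => ‖y‖ / R) x :=
    h3.mul_const R⁻¹
  have h5 : DifferentiableAt ℝ (fun y : EuclideanSpace ℝ (Fin N) => ∏ i, y i ^ t.monoExp i) x := by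
    fun_prop
  have h6 : DifferentiableAt ℝ (fun y : EuclideanSpace ℝ (Fin N) => (‖y‖ ^ t.normExp)⁻¹) x :=
    (h3.pow _).inv (pow_ne_zero _ (norm_ne_zero_iff.mpr hx))
  exact ((((((h1 _).comp x h4).pow p).mul ((h2 _).comp x h4)).mul h6).mul_const _).mul h5

lemma pd_eval (hφ : ContDiff ℝ (⊤ : ℕ∞) φ₀) (ht : ContDiff ℝ (⊤ : ℕ∞) t.coeff)
    (p : ℕ) (i : Fin N) {R : ℝ} (hR : 0 < R) {x : EuclideanSpace ℝ (Fin N)} (hx : x ≠ 0) :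
    pd N i (t.eval φ₀ (p + 1) R) x =
      (t.pdCoeff φ₀ p i).eval φ₀ p R x + (t.pdNorm φ₀ i).eval φ₀ p R x
        + (t.pdMono φ₀ i).eval φ₀ p R x := by
  rw [pd, ← (differentiableAt_eval hφ ht (p + 1) R hx).lineDeriv_eq_fderiv]
  have hn : ‖x‖ ≠ 0 := norm_ne_zero_iff.mpr hx
  have hN := hasDerivAt_norm_line hx i
  have hr := hN.div_const R
  have h0 : ‖x + (0 : ℝ) • EuclideanSpace.single i (1 : ℝ)‖ = ‖x‖ := by simp
  have h1 := ((hφ.differentiable (by simp) _).hasDerivAt.comp (0 : ℝ) hr).pow (p + 1)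
  have h2 := (ht.differentiable (by simp) _).hasDerivAt.comp (0 : ℝ) hr
  have h3 := (hN.pow t.normExp).inv (by simpa using fun h => absurd h hx)
  have h4 := (((h1.mul h2).mul h3).mul_const (R ^ t.scaleExp)⁻¹).mul
    (hasDerivAt_monomial_line x i t.monoExp)
  refine HasLineDerivAt.lineDeriv (HasDerivAt.congr_deriv h4 ?_)
  simp only [Pi.mul_apply, Pi.pow_apply, Pi.inv_apply, Function.comp_apply, zero_smul, add_zero,
    eval, pdCoeff, pdNorm, pdMono, prod_pow_add_single]
  rcases Nat.eq_zero_or_pos t.normExp with hb | hb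
  · simp only [hb]
    field_simp
    push_cast
    simp
    ring
  · obtain ⟨b, hb⟩ : ∃ b, t.normExp = b + 1 := ⟨t.normExp - 1, by omega⟩
    simp only [hb, Nat.add_sub_cancel]
    field_simp
    push_cast
    ring

end RadialTerm

lemma IsRadialSum.partialDeriv {φ₀ : ℝ → ℝ} {p d : ℕ} {F : ℝ → EuclideanSpace ℝ (Fin N) → ℝ}
    (hφ : ContDiff ℝ (⊤ : ℕ∞) φ₀) (hF : IsRadialSum φ₀ (p + 1) d F) (i : Fin N) :
    IsRadialSum φ₀ p (d + 1) (fun R => pd N i (F R)) := by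
  obtain ⟨L, hL, hF⟩ := hF
  have key : ∀ R : ℝ, 0 < R → ∀ x : EuclideanSpace ℝ (Fin N), x ≠ 0 →
      pd N i (F R) x =
        pd N i (fun y => (L.map fun t => t.eval φ₀ (p + 1) R y).sum) x := by
    intro R hR x hx
    have : F R =ᶠ[nhds x] fun y => (L.map fun t => t.eval φ₀ (p + 1) R y).sum := by
      filter_upwards [isOpen_ne.mem_nhds hx] with y hy using hF R hR y hy
    rw [pd, this.fderiv_eq, pd]
  suffices h : IsRadialSum φ₀ p (d + 1)
      (fun R => pd N i fun y => (L.map fun t => t.eval φ₀ (p + 1) R y).sum) by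
    obtain ⟨L', hL', h⟩ := h
    exact ⟨L', hL', fun R hR x hx => (key R hR x hx).trans (h R hR x hx)⟩
  clear key hF
  induction L with
  | nil => exact ⟨[], by simp, fun R _ x _ => by simp [pd]⟩
  | cons t L ih =>
    have ht : t.HasOrder d := hL t (by simp)
    obtain ⟨L', hL', h⟩ := ih fun s hs => hL s (by simp [hs])
    have hadd : ∀ R : ℝ, 0 < R → ∀ x : EuclideanSpace ℝ (Fin N), x ≠ 0 →
        pd N i (fun y => ((t :: L).map fun t => t.eval φ₀ (p + 1) R y).sum) x =
          (t.pdCoeff φ₀ p i).eval φ₀ p R x + (t.pdNorm φ₀ i).eval φ₀ p R x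
            + (t.pdMono φ₀ i).eval φ₀ p R x + (L'.map fun t => t.eval φ₀ p R x).sum := by
      intro R hR x hx
      have hd : DifferentiableAt ℝ (fun y => (L.map fun t => t.eval φ₀ (p + 1) R y).sum) x := by
        clear ih h
        induction L with
        | nil => simp
        | cons s L ih =>
          simp only [List.map_cons, List.sum_cons]
          exact (RadialTerm.differentiableAt_eval hφ (hL s (by simp)).contDiff _ R hx).add
            (ih fun u hu => hL u (by simp at hu ⊢; tauto))
      rw [← h R hR x hx, ← RadialTerm.pd_eval hφ ht.contDiff p i hR hx]
      simp only [List.map_cons, List.sum_cons, pd]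
      rw [fderiv_fun_add (RadialTerm.differentiableAt_eval hφ ht.contDiff _ R hx) hd]
      rfl
    by_cases hi : t.monoExp i = 0
    · refine ⟨t.pdCoeff φ₀ p i :: t.pdNorm φ₀ i :: L', ?_, fun R hR x hx => ?_⟩
      · simp only [List.mem_cons, forall_eq_or_imp]
        exact ⟨ht.pdCoeff hφ p i, ht.pdNorm hφ i, hL'⟩
      · refine (hadd R hR x hx).trans ?_
        rw [RadialTerm.eval_pdMono_eq_zero hi]
        simp only [List.map_cons, List.sum_cons]
        ring
    · refine ⟨t.pdCoeff φ₀ p i :: t.pdNorm φ₀ i :: t.pdMono φ₀ i :: L', ?_,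
        fun R hR x hx => ?_⟩
      · simp only [List.mem_cons, forall_eq_or_imp]
        exact ⟨ht.pdCoeff hφ p i, ht.pdNorm hφ i, ht.pdMono hφ hi, hL'⟩
      · refine (hadd R hR x hx).trans ?_
        simp only [List.map_cons, List.sum_cons]
        ring

lemma IsRadialSum.iterate_pd {φ₀ : ℝ → ℝ} (hφ : ContDiff ℝ (⊤ : ℕ∞) φ₀) (i : Fin N)
    {p d : ℕ} (k : ℕ) {F : ℝ → EuclideanSpace ℝ (Fin N) → ℝ}
    (hF : IsRadialSum φ₀ (p + k) d F) :
    IsRadialSum φ₀ p (d + k) (fun R => (pd N i)^[k] (F R)) := by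
  induction k generalizing p with
  | zero => exact hF
  | succ k ih =>
    simp only [Function.iterate_succ_apply']
    exact (ih (p := p + 1) (by convert hF using 1; omega)).partialDeriv hφ i

lemma IsRadialSum.foldr_pd {φ₀ : ℝ → ℝ} (hφ : ContDiff ℝ (⊤ : ℕ∞) φ₀) (η : Fin N → ℕ)
    (l : List (Fin N)) {p d : ℕ} {F : ℝ → EuclideanSpace ℝ (Fin N) → ℝ}
    (hF : IsRadialSum φ₀ (p + (l.map η).sum) d F) :
    IsRadialSum φ₀ p (d + (l.map η).sum)
      (fun R => l.foldr (fun i fc => (pd N i)^[η i] fc) (F R)) := by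
  induction l generalizing p with
  | nil => exact hF
  | cons i l ih =>
    simp only [List.foldr_cons, List.map_cons, List.sum_cons] at hF ⊢
    have h := (ih (p := p + η i) (by convert hF using 1; omega)).iterate_pd hφ i (η i)
    convert h using 1
    omega

lemma isRadialSum_pow {φ₀ : ℝ → ℝ} (hφ0 : ∀ z : ℝ, 2 ≤ |z| → φ₀ z = 0) {m : ℕ} (hm : m ≠ 0) :
    IsRadialSum (N := N) φ₀ m 0 (fun R y => φ₀ (‖y‖ / R) ^ m) := by
  let χ : ContDiffBump (0 : ℝ) := ⟨2, 3, by norm_num, by norm_num⟩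
  refine ⟨[⟨χ, 0, 0, 0⟩], ?_, fun R _ x _ => ?_⟩
  · simp only [List.mem_singleton, forall_eq]
    exact ⟨χ.contDiff, χ.hasCompactSupport, by simp⟩
  · simp only [List.map_cons, List.map_nil, List.sum_cons, List.sum_nil, RadialTerm.eval]
    rcases le_total 2 |‖x‖ / R| with h | h
    · simp [hφ0 _ h, hm]
    · have : χ (‖x‖ / R) = 1 := χ.one_of_mem_closedBall (mem_closedBall_zero_iff.mpr h)
      simp [this]

end Derivatives

/-- **Lemma 2.1, formula (2.1).** For `φ(x) = φ₀(|x|/R)^m` and a multi-index `η` with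
`0 < |η| < m`, on the annulus `A_R` the derivative `D^η φ` is a finite sum of terms
`φ₀(|x|/R)^{m-|η|} C_s(|x|/R) |x|^{-β_s} R^{-κ_s} ∏ᵢ xᵢ^{γ_s^i}` with
`β_s + κ_s - Σᵢ γ_s^i = |η|`, all data being independent of `R`. -/
theorem stmt_4
    (N : ℕ) (hN : 4 < N)
    (φ₀ : ℝ → ℝ) (hφsm : ContDiff ℝ (⊤ : ℕ∞) φ₀) (hφsupp : HasCompactSupport φ₀)
    (hφ1 : ∀ z : ℝ, |z| ≤ 1 → φ₀ z = 1)
    (hφ0 : ∀ z : ℝ, 2 ≤ |z| → φ₀ z = 0)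
    (hφpos : ∀ z : ℝ, |z| < 2 → 0 < φ₀ z ∧ φ₀ z ≤ 1)
    (m : ℕ) (hm : 1 < m)
    (η : Fin N → ℕ) (hη0 : 0 < ∑ i, η i) (hηm : ∑ i, η i < m) :
    ∃ (k : ℕ) (Cf : Fin k → ℝ → ℝ) (γ : Fin k → Fin N → ℕ) (β κ : Fin k → ℕ),
      (∀ s, ContDiff ℝ (⊤ : ℕ∞) (Cf s)) ∧
      (∀ s, HasCompactSupport (Cf s)) ∧
      (∀ s, (β s : ℤ) + (κ s : ℤ) - ∑ i, (γ s i : ℤ) = (∑ i, η i : ℤ)) ∧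
      ∀ R : ℝ, 0 < R → ∀ x : EuclideanSpace ℝ (Fin N), R ≤ ‖x‖ → ‖x‖ < 2 * R →
        mderiv N η (fun y => φ₀ (‖y‖ / R) ^ m) x =
          ∑ s, φ₀ (‖x‖ / R) ^ (m - ∑ i, η i) * Cf s (‖x‖ / R) *
            (‖x‖ ^ β s)⁻¹ * (R ^ κ s)⁻¹ * ∏ i, x i ^ γ s i := by
  have hsum : ((List.finRange N).map η).sum = ∑ i, η i := (Fin.sum_univ_def η).symm
  obtain ⟨L, hL, hF⟩ := IsRadialSum.foldr_pd (p := m - ∑ i, η i) hφsm η (List.finRange N)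
    (F := fun R y => φ₀ (‖y‖ / R) ^ m) (d := 0) (by
      rw [hsum, Nat.sub_add_cancel hηm.le]
      exact isRadialSum_pow hφ0 (by omega))
  rw [zero_add, hsum] at hL
  refine ⟨L.length, fun s => L[s].coeff, fun s => L[s].monoExp, fun s => L[s].normExp,
    fun s => L[s].scaleExp, fun s => (hL _ (List.getElem_mem _)).contDiff,
    fun s => (hL _ (List.getElem_mem _)).hasCompactSupport, fun s => ?_,
    fun R hR x hx _ => ?_⟩
  · have := (hL L[s] (List.getElem_mem _)).balance
    zify at this
    linarith
  · refine (hF R hR x (norm_pos_iff.mp (hR.trans_le hx))).trans ?_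
    rw [← Fin.sum_univ_fun_getElem]
    rfl
end

section
/- Let N > 4, 0 ≤ θ < 4, α > 0 and 1 < q < (N − θ + α(4 − θ))/(N − 4). Then, for all sufficiently large integers m (depending on α, q, θ), the cutoff family φ satisfies lim_{R→∞} ∫_{A_R} |x|^{θχ'/χ} |∇φ|^{4χ'} / φ^{3χ' + χ'/χ} dx = 0. -/
open MeasureTheory Filter

/-- The Laplacian of a (smooth) function `f`. -/
noncomputable def lapS (N : ℕ) (f : EuclideanSpace ℝ (Fin N) → ℝ)
    (x : EuclideanSpace ℝ (Fin N)) : ℝ :=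
  ∑ i : Fin N, pd N i (fun y => pd N i f y) x

/-- Gradient bound for a power of a rescaled radial profile. -/
lemma norm_fderiv_radial_pow_le {E : Type*} [NormedAddCommGroup E] [InnerProductSpace ℝ E]
    {f : ℝ → ℝ} (hf : Differentiable ℝ f) {C : ℝ} (hC : ∀ z, ‖deriv f z‖ ≤ C)
    (m : ℕ) {R : ℝ} (hR : 0 < R) {x : E} (hx : x ≠ 0) (hfx : 0 ≤ f (‖x‖ / R)) :
    ‖fderiv ℝ (fun y => f (‖y‖ / R) ^ m) x‖ ≤ m * C / R * f (‖x‖ / R) ^ (m - 1) := by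
  have hg : DifferentiableAt ℝ (fun y : E => ‖y‖ / R) x :=
    ((contDiffAt_norm ℝ hx (n := 1)).differentiableAt one_ne_zero).mul_const R⁻¹
  have hgn : ‖fderiv ℝ (fun y : E => ‖y‖ / R) x‖ ≤ 1 / R := by
    refine norm_fderiv_le_of_lip' ℝ (by positivity) (Eventually.of_forall fun y => ?_)
    rw [← sub_div, norm_div, Real.norm_of_nonneg hR.le, div_mul_eq_mul_div, one_mul]
    gcongr
    exact abs_norm_sub_norm_le y x
  have hd := ((hf (‖x‖ / R)).hasDerivAt.pow m).comp_hasFDerivAt x hg.hasFDerivAt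
  have hd' : fderiv ℝ (fun y => f (‖y‖ / R) ^ m) x = _ := hd.fderiv
  have hp : 0 ≤ f (‖x‖ / R) ^ (m - 1) := pow_nonneg hfx _
  have hC0 : 0 ≤ C := (norm_nonneg _).trans (hC 0)
  rw [hd', norm_smul, norm_mul, norm_mul, Real.norm_of_nonneg hp, Real.norm_natCast]
  calc (m : ℝ) * f (‖x‖ / R) ^ (m - 1) * ‖deriv f (‖x‖ / R)‖ *
        ‖fderiv ℝ (fun y : E => ‖y‖ / R) x‖
      ≤ m * f (‖x‖ / R) ^ (m - 1) * C * (1 / R) := by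
        gcongr
        exact hC _
    _ = m * C / R * f (‖x‖ / R) ^ (m - 1) := by ring

/-- Absorption of the negative power of the cutoff by the power coming from its gradient. -/
lemma weighted_quotient_le {a b c r R G D t : ℝ} {m : ℕ} (ha : 0 ≤ a) (hb : 0 ≤ b)
    (hR : 0 < R) (hr0 : 0 ≤ r) (hr : r ≤ 2 * R) (hD : 0 ≤ D) (ht0 : 0 < t) (ht1 : t ≤ 1)
    (hm : 1 ≤ m) (hmc : m * c ≤ (m - 1) * b) (hG0 : 0 ≤ G) (hG : G ≤ D / R * t ^ (m - 1)) :
    r ^ a * G ^ b / (t ^ m) ^ c ≤ 2 ^ a * D ^ b * R ^ (a - b) := by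
  have key : (t ^ (m - 1)) ^ b ≤ (t ^ m) ^ c := by
    rw [← Real.rpow_natCast_mul ht0.le, ← Real.rpow_natCast_mul ht0.le]
    refine Real.rpow_le_rpow_of_exponent_ge ht0 ht1 ?_
    rwa [Nat.cast_sub hm, Nat.cast_one]
  rw [div_le_iff₀ (by positivity)]
  calc r ^ a * G ^ b ≤ (2 * R) ^ a * (D / R * t ^ (m - 1)) ^ b := by gcongr
    _ = 2 ^ a * D ^ b * R ^ (a - b) * (t ^ (m - 1)) ^ b := by
      rw [Real.mul_rpow (by positivity) (by positivity),
        Real.mul_rpow (by positivity) (by positivity), Real.div_rpow hD hR.le,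
        Real.rpow_sub hR]
      ring
    _ ≤ _ := by gcongr

/-- **Corollary 2.1 (i).** With `χ = (α+q)/(α+1)`, `χ' = (α+q)/(q-1)` and
`1 < q < (N - θ + α(4-θ))/(N-4)`, for every sufficiently large exponent `m` the
cutoff family `φ(x) = φ₀(|x|/R)^m` satisfies
`lim_{R→∞} ∫_{A_R} |x|^{θχ'/χ} |∇φ|^{4χ'} / φ^{3χ' + χ'/χ} = 0`. -/
theorem stmt_6
    (N : ℕ) (hN : 4 < N) (θ α q : ℝ) (hθ0 : 0 ≤ θ) (hθ4 : θ < 4)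
    (hα : 0 < α) (hq : 1 < q)
    (hcrit : q < ((N : ℝ) - θ + α * (4 - θ)) / ((N : ℝ) - 4))
    (χ χ' : ℝ) (hχ : χ = (α + q) / (α + 1)) (hχ' : χ' = (α + q) / (q - 1))
    (φ₀ : ℝ → ℝ) (hφsm : ContDiff ℝ (⊤ : ℕ∞) φ₀) (hφsupp : HasCompactSupport φ₀)
    (hφ1 : ∀ z : ℝ, |z| ≤ 1 → φ₀ z = 1)
    (hφ0 : ∀ z : ℝ, 2 ≤ |z| → φ₀ z = 0)
    (hφpos : ∀ z : ℝ, |z| < 2 → 0 < φ₀ z ∧ φ₀ z ≤ 1) :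
    ∃ m₀ : ℕ, ∀ m : ℕ, m₀ ≤ m →
      Tendsto (fun R : ℝ =>
          ∫⁻ x in {x : EuclideanSpace ℝ (Fin N) | R ≤ ‖x‖ ∧ ‖x‖ < 2 * R},
            ENNReal.ofReal (‖x‖ ^ (θ * χ' / χ) *
              ‖fderiv ℝ (fun y => φ₀ (‖y‖ / R) ^ m) x‖ ^ (4 * χ') /
              (φ₀ (‖x‖ / R) ^ m) ^ (3 * χ' + χ' / χ)))
        atTop (nhds 0) := by
  have hq1 : 0 < q - 1 := by linarith
  have hχpos : 0 < χ' := by rw [hχ']; positivity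
  have hconj : χ' / χ = χ' - 1 := by
    have : α + q ≠ 0 := by positivity
    rw [hχ, hχ']
    field_simp
    ring
  have hconj0 : 0 ≤ χ' / χ := by rw [hχ]; positivity
  have hN4 : (0 : ℝ) < N - 4 := by
    have : (4 : ℝ) < N := by exact_mod_cast hN
    linarith
  have hexp : θ * χ' / χ - 4 * χ' + N < 0 := by
    rw [lt_div_iff₀ hN4] at hcrit
    have h : θ * χ' / χ - 4 * χ' + N =
        (q * (N - 4) - (N - θ + α * (4 - θ))) / (q - 1) := by
      rw [mul_div_assoc, hconj, hχ']
      field_simp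
      ring
    rw [h]
    exact div_neg_of_neg_of_pos (by linarith) hq1
  have hdiff : Differentiable ℝ φ₀ := hφsm.differentiable (by simp)
  obtain ⟨C, hC⟩ := (hφsm.continuous_deriv (by simp)).bounded_above_of_compact_support
    hφsupp.deriv
  have hC0 : 0 ≤ C := (norm_nonneg _).trans (hC 0)
  refine ⟨⌈4 * χ'⌉₊, fun m hm => ?_⟩
  have hm4 : 4 * χ' ≤ m := Nat.ceil_le.mp hm
  have hm1 : 1 ≤ m := (Nat.ceil_pos.mpr (by positivity)).trans_le hm
  set K : ℝ := 2 ^ (θ * χ' / χ) * (m * C) ^ (4 * χ') with hK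
  have hK0 : 0 ≤ K := by positivity
  set V : ENNReal := volume (Metric.ball (0 : EuclideanSpace ℝ (Fin N)) 1) with hV
  have hlim : Tendsto (fun R : ℝ =>
      ENNReal.ofReal (K * 2 ^ N * R ^ (θ * χ' / χ - 4 * χ' + N)) * V) atTop (nhds 0) := by
    have h1 := (tendsto_rpow_neg_atTop (neg_pos.mpr hexp)).const_mul (K * 2 ^ N)
    rw [neg_neg, mul_zero] at h1
    have h2 := ENNReal.Tendsto.mul_const (ENNReal.tendsto_ofReal h1)
      (Or.inr (measure_ball_lt_top (μ := volume)
        (x := (0 : EuclideanSpace ℝ (Fin N))) (r := 1)).ne)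
    rwa [ENNReal.ofReal_zero, zero_mul] at h2
  refine tendsto_of_tendsto_of_tendsto_of_le_of_le' tendsto_const_nhds hlim
    (Eventually.of_forall fun _ => zero_le) ?_
  filter_upwards [eventually_gt_atTop 0] with R hR
  have hS : MeasurableSet {x : EuclideanSpace ℝ (Fin N) | R ≤ ‖x‖ ∧ ‖x‖ < 2 * R} :=
    (measurableSet_le measurable_const measurable_norm).inter
      (measurableSet_lt measurable_norm measurable_const)
  calc _ ≤ ∫⁻ _ in {x : EuclideanSpace ℝ (Fin N) | R ≤ ‖x‖ ∧ ‖x‖ < 2 * R},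
        ENNReal.ofReal (K * R ^ (θ * χ' / χ - 4 * χ')) := by
        refine setLIntegral_mono' hS fun x hx => ENNReal.ofReal_le_ofReal ?_
        have hlt : |‖x‖ / R| < 2 := by
          rw [abs_of_nonneg (by positivity), div_lt_iff₀ hR]
          exact hx.2
        obtain ⟨ht0, ht1⟩ := hφpos _ hlt
        refine weighted_quotient_le (by rw [mul_div_assoc]; positivity) (by positivity) hR
          (norm_nonneg x) hx.2.le (by positivity) ht0 ht1 hm1 ?_ (norm_nonneg _)
          (norm_fderiv_radial_pow_le hdiff hC m hR
            (norm_pos_iff.mp (hR.trans_le hx.1)) ht0.le)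
        rw [hconj]
        linarith
    _ ≤ ENNReal.ofReal (K * R ^ (θ * χ' / χ - 4 * χ')) *
        volume (Metric.ball (0 : EuclideanSpace ℝ (Fin N)) (2 * R)) := by
        rw [setLIntegral_const]
        gcongr
        exact fun x hx => mem_ball_zero_iff.mpr hx.2
    _ = _ := by
        rw [Measure.addHaar_ball_of_pos _ _ (by positivity), finrank_euclideanSpace_fin, ← mul_assoc,
          ← ENNReal.ofReal_mul (by positivity), Real.rpow_add hR, Real.rpow_natCast, mul_pow]
        congr 2
        ring
end

section
/- Let N > 4, 0 ≤ θ < 4, α > 0 and 1 < q < (N − θ + α(4 − θ))/(N − 4). Then, for all sufficiently large integers m (depending on α, q, θ), the cutoff family φ satisfies lim_{R→∞} ∫_{A_R} |x|^{θχ'/χ} (Δφ)^{2χ'} / φ^{χ' + χ'/χ} dx = 0. -/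
open MeasureTheory Filter

lemma pd_comp_smul {N : ℕ} (i : Fin N) (g : EuclideanSpace ℝ (Fin N) → ℝ) (c : ℝ)
    (x : EuclideanSpace ℝ (Fin N)) :
    pd N i (fun y => g (c • y)) x = c * pd N i g (c • x) := by
  unfold pd
  rw [fderiv_comp_smul]
  simp

lemma pd_const_mul {N : ℕ} (i : Fin N) (g : EuclideanSpace ℝ (Fin N) → ℝ) (c : ℝ)
    (x : EuclideanSpace ℝ (Fin N)) :
    pd N i (fun y => c * g y) x = c * pd N i g x := by
  unfold pd
  rw [show (fun y => c * g y) = c • g from rfl, fderiv_const_smul_field]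
  simp

lemma pd_pow {N : ℕ} (i : Fin N) {g : EuclideanSpace ℝ (Fin N) → ℝ} (hg : Differentiable ℝ g)
    (m : ℕ) (x : EuclideanSpace ℝ (Fin N)) :
    pd N i (fun y => g y ^ m) x = m * g x ^ (m - 1) * pd N i g x := by
  unfold pd
  rw [((hg x).hasFDerivAt.pow m).fderiv]
  simp

lemma pd_mul {N : ℕ} (i : Fin N) {f g : EuclideanSpace ℝ (Fin N) → ℝ} (hf : Differentiable ℝ f)
    (hg : Differentiable ℝ g) (x : EuclideanSpace ℝ (Fin N)) :
    pd N i (fun y => f y * g y) x = f x * pd N i g x + g x * pd N i f x := by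
  unfold pd
  rw [fderiv_fun_mul (hf x) (hg x)]
  simp

lemma contDiff_pd {N : ℕ} (i : Fin N) {g : EuclideanSpace ℝ (Fin N) → ℝ}
    (hg : ContDiff ℝ (⊤ : ℕ∞) g) : ContDiff ℝ (⊤ : ℕ∞) (pd N i g) :=
  (hg.fderiv_right (m := (⊤ : ℕ∞)) (by simp)).clm_apply contDiff_const

lemma hasCompactSupport_pd {N : ℕ} (i : Fin N) {g : EuclideanSpace ℝ (Fin N) → ℝ}
    (hg : HasCompactSupport g) : HasCompactSupport (pd N i g) :=
  hg.fderiv_apply ℝ _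

lemma lapS_comp_smul {N : ℕ} (g : EuclideanSpace ℝ (Fin N) → ℝ) (c : ℝ)
    (x : EuclideanSpace ℝ (Fin N)) :
    lapS N (fun y => g (c • y)) x = c ^ 2 * lapS N g (c • x) := by
  unfold lapS
  rw [Finset.mul_sum]
  refine Finset.sum_congr rfl fun i _ => ?_
  simp_rw [pd_comp_smul i g]
  rw [pd_const_mul i (fun y => pd N i g (c • y)), pd_comp_smul i (fun y => pd N i g y)]
  ring

/-- The Laplacian of the `m`-th power of a test function `g` with values in `[0, 1]` is
controlled by `g ^ (m - 2)`. -/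
lemma exists_abs_lapS_pow_le {N : ℕ} {g : EuclideanSpace ℝ (Fin N) → ℝ}
    (hg : ContDiff ℝ (⊤ : ℕ∞) g) (hgs : HasCompactSupport g) (hg0 : ∀ x, 0 ≤ g x)
    (hg1 : ∀ x, g x ≤ 1) {m : ℕ} (hm : 2 ≤ m) :
    ∃ K : ℝ, 0 < K ∧ ∀ x, |lapS N (fun y => g y ^ m) x| ≤ K * g x ^ (m - 2) := by
  have hpd (i : Fin N) := contDiff_pd i hg
  choose A hA using fun i : Fin N =>
    (hpd i).continuous.bounded_above_of_compact_support (hasCompactSupport_pd i hgs)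
  choose B hB using fun i : Fin N =>
    (contDiff_pd i (hpd i)).continuous.bounded_above_of_compact_support
      (hasCompactSupport_pd i (hasCompactSupport_pd i hgs))
  obtain ⟨k, rfl⟩ := Nat.exists_eq_add_of_le' hm
  have key (i : Fin N) (x : EuclideanSpace ℝ (Fin N)) :
      |pd N i (fun y => pd N i (fun z => g z ^ (k + 2)) y) x| ≤
        ((k + 2) * (k + 1) * A i ^ 2 + (k + 2) * B i) * g x ^ k := by
    have hd : Differentiable ℝ g := hg.differentiable (by simp)
    have hgk := pow_nonneg (hg0 x) k
    have e : pd N i (fun y => pd N i (fun z => g z ^ (k + 2)) y) x =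
        ((k + 2) * (k + 1) * pd N i g x ^ 2 + (k + 2) * (g x * pd N i (pd N i g) x)) *
          g x ^ k := by
      simp_rw [pd_pow i hd]
      rw [pd_mul i ((hd.fun_pow _).const_mul _) ((hpd i).differentiable (by simp)),
        pd_const_mul i (fun y => g y ^ (k + 2 - 1)), pd_pow i hd]
      simp only [Nat.add_succ_sub_one, Nat.add_sub_cancel]
      push_cast
      ring
    rw [e, abs_mul, abs_of_nonneg hgk]
    refine mul_le_mul_of_nonneg_right ((abs_add_le _ _).trans (add_le_add ?_ ?_)) hgk
    · rw [abs_mul, abs_of_nonneg (by positivity), abs_pow]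
      have := hA i x
      rw [Real.norm_eq_abs] at this
      gcongr
    · rw [abs_mul, abs_of_nonneg (by positivity), abs_mul, abs_of_nonneg (hg0 x)]
      have := hB i x
      rw [Real.norm_eq_abs] at this
      gcongr
      exact (mul_le_of_le_one_left (abs_nonneg _) (hg1 x)).trans this
  refine ⟨max 1 (∑ i, ((k + 2) * (k + 1) * A i ^ 2 + (k + 2) * B i)), by positivity, fun x => ?_⟩
  simp only [Nat.add_sub_cancel]
  refine le_trans ?_ (mul_le_mul_of_nonneg_right (le_max_right _ _) (pow_nonneg (hg0 x) k))
  rw [Finset.sum_mul]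
  exact (Finset.abs_sum_le_sum_abs _ _).trans (Finset.sum_le_sum fun i _ => key i x)

lemma contDiff_comp_norm {E : Type*} [NormedAddCommGroup E] [InnerProductSpace ℝ E]
    {φ : ℝ → ℝ} (hφ : ContDiff ℝ (⊤ : ℕ∞) φ) {c : ℝ} (h : ∀ z : ℝ, |z| ≤ 1 → φ z = c) :
    ContDiff ℝ (⊤ : ℕ∞) (fun x : E => φ ‖x‖) := by
  rw [contDiff_iff_contDiffAt]
  intro x
  by_cases hx : x = 0
  · refine (contDiffAt_const (c := c)).congr_of_eventuallyEq ?_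
    filter_upwards [Metric.ball_mem_nhds x one_pos] with y hy
    refine h _ ?_
    rw [abs_norm]
    simpa [hx] using (mem_ball_iff_norm.1 hy).le
  · exact hφ.contDiffAt.comp x (contDiffAt_norm ℝ hx)

/-- Pointwise estimate of the weighted integrand, with `t` standing for the cutoff value,
`r` for `‖x‖` and `L` for the Laplacian. -/
lemma rpow_mul_rpow_div_le {K R r t L a s : ℝ} {m : ℕ} (hK : 0 < K) (hR : 0 < R)
    (hr0 : 0 ≤ r) (hr : r ≤ 2 * R) (ht0 : 0 < t) (ht1 : t ≤ 1) (ha : 0 ≤ a) (hs : 0 ≤ s)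
    (hm2 : 2 ≤ m) (hm : 2 * s ≤ m)
    (hL : |L| ≤ R⁻¹ ^ 2 * (K * t ^ (m - 2))) :
    r ^ a * |L| ^ s / (t ^ m) ^ (s - 1) ≤ 2 ^ a * K ^ s * R ^ (a - 2 * s) := by
  have h1 : r ^ a ≤ 2 ^ a * R ^ a := by
    rw [← Real.mul_rpow (by norm_num) hR.le]
    gcongr
  have h2 : |L| ^ s ≤ R ^ (-(2 * s)) * (K ^ s * t ^ ((m - 2 : ℝ) * s)) := by
    refine (Real.rpow_le_rpow (abs_nonneg _) hL hs).trans_eq ?_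
    rw [Real.mul_rpow (by positivity) (by positivity), Real.mul_rpow hK.le (by positivity)]
    congr 1
    · rw [inv_pow, Real.inv_rpow (by positivity), ← Real.rpow_natCast R 2,
        ← Real.rpow_mul hR.le, ← Real.rpow_neg hR.le]
      norm_num
    · rw [← Real.rpow_natCast t, ← Real.rpow_mul ht0.le, Nat.cast_sub hm2]
      norm_num
  have h3 : (t ^ m) ^ (s - 1) = t ^ ((m : ℝ) * (s - 1)) := by
    rw [← Real.rpow_natCast t, ← Real.rpow_mul ht0.le]
  rw [h3, div_le_iff₀ (by positivity)]
  have h4 : t ^ ((m - 2 : ℝ) * s) ≤ t ^ ((m : ℝ) * (s - 1)) :=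
    Real.rpow_le_rpow_of_exponent_ge ht0 ht1 (by nlinarith)
  calc r ^ a * |L| ^ s
      ≤ (2 ^ a * R ^ a) * (R ^ (-(2 * s)) * (K ^ s * t ^ ((m : ℝ) * (s - 1)))) := by
        refine mul_le_mul h1 (h2.trans ?_) (by positivity) (by positivity)
        gcongr
    _ = 2 ^ a * K ^ s * R ^ (a - 2 * s) * t ^ ((m : ℝ) * (s - 1)) := by
        rw [sub_eq_add_neg a, Real.rpow_add hR]
        ring

/-- **Corollary 2.1 (ii).** With `χ = (α+q)/(α+1)`, `χ' = (α+q)/(q-1)` and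
`1 < q < (N - θ + α(4-θ))/(N-4)`, for every sufficiently large exponent `m` the
cutoff family `φ(x) = φ₀(|x|/R)^m` satisfies
`lim_{R→∞} ∫_{A_R} |x|^{θχ'/χ} (Δφ)^{2χ'} / φ^{χ' + χ'/χ} = 0`. -/
theorem stmt_7
    (N : ℕ) (hN : 4 < N) (θ α q : ℝ) (hθ0 : 0 ≤ θ) (hθ4 : θ < 4)
    (hα : 0 < α) (hq : 1 < q)
    (hcrit : q < ((N : ℝ) - θ + α * (4 - θ)) / ((N : ℝ) - 4))
    (χ χ' : ℝ) (hχ : χ = (α + q) / (α + 1)) (hχ' : χ' = (α + q) / (q - 1))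
    (φ₀ : ℝ → ℝ) (hφsm : ContDiff ℝ (⊤ : ℕ∞) φ₀) (hφsupp : HasCompactSupport φ₀)
    (hφ1 : ∀ z : ℝ, |z| ≤ 1 → φ₀ z = 1)
    (hφ0 : ∀ z : ℝ, 2 ≤ |z| → φ₀ z = 0)
    (hφpos : ∀ z : ℝ, |z| < 2 → 0 < φ₀ z ∧ φ₀ z ≤ 1) :
    ∃ m₀ : ℕ, ∀ m : ℕ, m₀ ≤ m →
      Tendsto (fun R : ℝ =>
          ∫⁻ x in {x : EuclideanSpace ℝ (Fin N) | R ≤ ‖x‖ ∧ ‖x‖ < 2 * R},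
            ENNReal.ofReal (‖x‖ ^ (θ * χ' / χ) *
              |lapS N (fun y => φ₀ (‖y‖ / R) ^ m) x| ^ (2 * χ') /
              (φ₀ (‖x‖ / R) ^ m) ^ (χ' + χ' / χ)))
        atTop (nhds 0) := by
  have hN4 : (0 : ℝ) < N - 4 := by
    have : (4 : ℝ) < N := by exact_mod_cast hN
    linarith
  have hq1 : 0 < q - 1 := by linarith
  have hαq : 0 < α + q := by linarith
  have hs : 0 < χ' := by rw [hχ']; positivity
  have hdiv : χ' / χ = χ' - 1 := by
    rw [hχ, hχ']
    field_simp
    ring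
  have ha : 0 ≤ θ * χ' / χ := by
    rw [hχ]
    positivity
  have hneg : θ * χ' / χ - 2 * (2 * χ') + N < 0 := by
    rw [mul_div_assoc, hdiv]
    rw [lt_div_iff₀ hN4] at hcrit
    have : θ * (χ' - 1) - 2 * (2 * χ') + N =
        (q * (N - 4) - (N - θ + α * (4 - θ))) / (q - 1) := by
      rw [hχ']
      field_simp
      ring
    rw [this]
    exact div_neg_of_neg_of_pos (by linarith) hq1
  refine ⟨max 2 ⌈2 * (2 * χ')⌉₊, fun m hm => ?_⟩
  have hm2 : 2 ≤ m := (le_max_left _ _).trans hm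
  have hms : 2 * (2 * χ') ≤ m := Nat.ceil_le.1 ((le_max_right _ _).trans hm)
  have hbd (z : ℝ) : 0 ≤ φ₀ z ∧ φ₀ z ≤ 1 := by
    rcases lt_or_ge |z| 2 with h | h
    · exact ⟨(hφpos z h).1.le, (hφpos z h).2⟩
    · simp [hφ0 z h]
  obtain ⟨K, hK, hKb⟩ := exists_abs_lapS_pow_le (N := N) (contDiff_comp_norm hφsm hφ1)
    (HasCompactSupport.intro (isCompact_closedBall 0 2) fun x hx => hφ0 _ (by
      rw [abs_norm]
      simpa using (not_le.1 (mt mem_closedBall_zero_iff.2 hx)).le))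
    (fun x => (hbd _).1) (fun x => (hbd _).2) hm2
  set a := θ * χ' / χ with ha_def
  set V := volume (Metric.ball (0 : EuclideanSpace ℝ (Fin N)) 1) with hV
  set C := 2 ^ a * K ^ (2 * χ') with hC
  have hup : ∀ R : ℝ, 0 < R →
      ∫⁻ x in {x : EuclideanSpace ℝ (Fin N) | R ≤ ‖x‖ ∧ ‖x‖ < 2 * R},
            ENNReal.ofReal (‖x‖ ^ a *
              |lapS N (fun y => φ₀ (‖y‖ / R) ^ m) x| ^ (2 * χ') /
              (φ₀ (‖x‖ / R) ^ m) ^ (χ' + χ' / χ)) ≤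
        ENNReal.ofReal (C * 2 ^ N * R ^ (a - 2 * (2 * χ') + N)) * V := by
    intro R hR
    have hsc (y : EuclideanSpace ℝ (Fin N)) : ‖y‖ / R = ‖R⁻¹ • y‖ := by
      rw [norm_smul, norm_inv, Real.norm_of_nonneg hR.le]
      ring
    have hexp : χ' + χ' / χ = 2 * χ' - 1 := by
      rw [hdiv]
      ring
    calc _ ≤ ∫⁻ _ in {x : EuclideanSpace ℝ (Fin N) | R ≤ ‖x‖ ∧ ‖x‖ < 2 * R},
            ENNReal.ofReal (C * R ^ (a - 2 * (2 * χ'))) := by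
          refine setLIntegral_mono measurable_const fun x hx => ?_
          refine ENNReal.ofReal_le_ofReal ?_
          rw [hexp]
          have hlt : |‖x‖ / R| < 2 := by
            rw [abs_of_nonneg (by positivity), div_lt_iff₀ hR]
            exact hx.2
          refine rpow_mul_rpow_div_le hK hR (norm_nonneg x) hx.2.le (hφpos _ hlt).1
            (hφpos _ hlt).2 ha (by positivity) hm2 hms ?_
          simp_rw [hsc]
          rw [lapS_comp_smul (fun y => φ₀ ‖y‖ ^ m), abs_mul, abs_of_nonneg (by positivity)]
          exact mul_le_mul_of_nonneg_left (hKb _) (by positivity)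
      _ ≤ ENNReal.ofReal (C * R ^ (a - 2 * (2 * χ'))) *
            volume (Metric.ball (0 : EuclideanSpace ℝ (Fin N)) (2 * R)) := by
          rw [setLIntegral_const]
          gcongr
          exact fun x hx => by simpa using hx.2
      _ = _ := by
          rw [Measure.addHaar_ball_of_pos _ _ (by positivity), ← mul_assoc,
            ← ENNReal.ofReal_mul (by positivity), finrank_euclideanSpace_fin,
            Real.rpow_add hR, Real.rpow_natCast, mul_pow]
          congr 2
          ring
  have hlim : Tendsto (fun R : ℝ => ENNReal.ofReal (C * 2 ^ N * R ^ (a - 2 * (2 * χ') + N)) * V)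
      atTop (nhds 0) := by
    have h1 : Tendsto (fun R : ℝ => C * 2 ^ N * R ^ (a - 2 * (2 * χ') + N)) atTop (nhds 0) := by
      have := (tendsto_rpow_neg_atTop (neg_pos.2 hneg)).const_mul (C * 2 ^ N)
      simpa only [neg_neg, mul_zero] using this
    have h2 := ENNReal.Tendsto.mul_const (ENNReal.tendsto_ofReal h1) (b := V)
      (Or.inr measure_ball_lt_top.ne)
    simpa using h2
  refine tendsto_of_tendsto_of_tendsto_of_le_of_le' tendsto_const_nhds hlim
    (Eventually.of_forall fun _ => zero_le) ?_
  filter_upwards [eventually_gt_atTop 0] with R hR using hup R hR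
end
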